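/- Let 1 < p < ∞. There is a constant C, depending only on p and n, such that for every cube Q_0 ⊂ ℝ^n and every f ∈ L^1(Q_0), ‖f − f_{Q_0}‖_{L^{p,∞},Q_0} ≤ C‖M^#_{Q_0}f‖_{L^{p,∞},Q_0}, where M^#_{Q_0} is the local dyadic sharp maximal function. -/

import Mathlib

open MeasureTheory Filter
open scoped ENNReal NNReal Topology

structure Cube (n : ℕ) where
  corner : Fin n → ℝ
  side : ℝ
  side_pos : 0 < side

namespace Cube

variable {n : ℕ}

/-- The (half-open) cube determined by the data. -/
def set (Q : Cube n) : Set (Fin n → ℝ) :=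
  {x | ∀ i, Q.corner i ≤ x i ∧ x i < Q.corner i + Q.side}

/-- The dyadic subcube of `Q` of generation `k` in position `m`. -/
noncomputable def dyadic (Q : Cube n) (k : ℕ) (m : Fin n → ℕ) : Cube n :=
  ⟨fun i => Q.corner i + Q.side / 2 ^ k * (m i : ℝ), Q.side / 2 ^ k,
    div_pos Q.side_pos (by positivity)⟩

/-- `Q` belongs to the family `𝒟(Q₀)` of dyadic subcubes of `Q₀`. -/
def IsDyadicSub (Q₀ Q : Cube n) : Prop :=
  ∃ (k : ℕ) (m : Fin n → ℕ), (∀ i, m i < 2 ^ k) ∧ Q = Q₀.dyadic k m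

/-- The average `(1/|Q|)∫_Q f dx` (of a nonnegative function), with values in `ℝ≥0∞`. -/
noncomputable def avg (Q : Cube n) (f : (Fin n → ℝ) → ℝ) : ℝ≥0∞ :=
  (∫⁻ x in Q.set, ENNReal.ofReal (f x)) / volume Q.set

/-- The (real-valued) average `f_Q = (1/|Q|)∫_Q f dx`. -/
noncomputable def ravg (Q : Cube n) (f : (Fin n → ℝ) → ℝ) : ℝ :=
  ⨍ x in Q.set, f x

/-- The local dyadic maximal function `M_{Q₀} f`. -/
noncomputable def maximal (Q₀ : Cube n) (f : (Fin n → ℝ) → ℝ) (x : Fin n → ℝ) : ℝ≥0∞ :=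
  ⨆ (k : ℕ) (m : Fin n → ℕ) (_ : (∀ i, m i < 2 ^ k) ∧ x ∈ (Q₀.dyadic k m).set),
    avg (Q₀.dyadic k m) f

/-- `G*_{Q₀}(x) = sup { g(Q) : Q ∈ 𝒟(Q₀), x ∈ Q }`. -/
noncomputable def gstar (Q₀ : Cube n) (g : Cube n → ℝ) (x : Fin n → ℝ) : ℝ≥0∞ :=
  ⨆ (k : ℕ) (m : Fin n → ℕ) (_ : (∀ i, m i < 2 ^ k) ∧ x ∈ (Q₀.dyadic k m).set),
    ENNReal.ofReal (g (Q₀.dyadic k m))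

/-- The local dyadic sharp maximal function `M^#_{Q₀} f`. -/
noncomputable def sharpMaximal (Q₀ : Cube n) (f : (Fin n → ℝ) → ℝ) (x : Fin n → ℝ) : ℝ≥0∞ :=
  ⨆ (k : ℕ) (m : Fin n → ℕ) (_ : (∀ i, m i < 2 ^ k) ∧ x ∈ (Q₀.dyadic k m).set),
    avg (Q₀.dyadic k m) (fun y => |f y - ravg (Q₀.dyadic k m) f|)

/-- The normalized weak `L^p` (quasi-)norm on a cube, for an `ℝ≥0∞`-valued function. -/
noncomputable def wnorm (Q : Cube n) (p : ℝ) (f : (Fin n → ℝ) → ℝ≥0∞) : ℝ≥0∞ :=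
  ⨆ (t : ℝ) (_ : 0 < t),
    ENNReal.ofReal t * (volume {x ∈ Q.set | ENNReal.ofReal t < f x} / volume Q.set) ^ (1 / p)

/-- The normalized `L^p` norm `((1/|Q|)∫_Q f^p dx)^{1/p}` for an `ℝ≥0∞`-valued function. -/
noncomputable def lpnorm (Q : Cube n) (p : ℝ) (f : (Fin n → ℝ) → ℝ≥0∞) : ℝ≥0∞ :=
  ((∫⁻ x in Q.set, f x ^ p) / volume Q.set) ^ (1 / p)

/-- The dyadic John–Nirenberg functional `‖f‖_{JN_p^{dyadic},Q}`. -/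
noncomputable def jnNorm (Q : Cube n) (p : ℝ) (f : (Fin n → ℝ) → ℝ) : ℝ≥0∞ :=
  ⨆ (𝒮 : Set (Cube n)) (_ : (∀ R ∈ 𝒮, Q.IsDyadicSub R) ∧ 𝒮.PairwiseDisjoint Cube.set),
    ((∑' R : 𝒮, avg (R : Cube n) (fun x => |f x - ravg (R : Cube n) f|) ^ p *
        volume (R : Cube n).set) / volume Q.set) ^ (1 / p)

/-- `sup ((1/|Q|) Σ_i a(Q_i)^p |Q_i|)^{1/p}` over pairwise disjoint families in `𝒟(Q)`. -/
noncomputable def dpSup (Q : Cube n) (p : ℝ) (a : Cube n → ℝ) : ℝ≥0∞ :=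
  ⨆ (𝒮 : Set (Cube n)) (_ : (∀ R ∈ 𝒮, Q.IsDyadicSub R) ∧ 𝒮.PairwiseDisjoint Cube.set),
    ((∑' R : 𝒮, ENNReal.ofReal (a (R : Cube n)) ^ p * volume (R : Cube n).set) /
      volume Q.set) ^ (1 / p)

/-- `‖a‖_{D_p,Q}`. -/
noncomputable def dpNorm (Q : Cube n) (p : ℝ) (a : Cube n → ℝ) : ℝ≥0∞ :=
  dpSup Q p a / ENNReal.ofReal (a Q)

/-- `‖a‖_{D_p^{dyadic}(Q₀)}`. -/
noncomputable def dpGlobal (Q₀ : Cube n) (p : ℝ) (a : Cube n → ℝ) : ℝ≥0∞ :=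
  ⨆ (Q : Cube n) (_ : Q₀.IsDyadicSub Q), dpNorm Q p a

end Cube

namespace Cube

variable {n : ℕ}

theorem set_eq_pi (Q : Cube n) :
    Q.set = Set.univ.pi fun i => Set.Ico (Q.corner i) (Q.corner i + Q.side) := by
  ext x
  simp [set]

theorem measurableSet_set (Q : Cube n) : MeasurableSet Q.set := by
  rw [set_eq_pi]
  exact MeasurableSet.univ_pi fun i => measurableSet_Ico

theorem volume_set (Q : Cube n) : volume Q.set = ENNReal.ofReal Q.side ^ n := by
  rw [set_eq_pi, volume_pi_pi]
  simp

theorem volume_set_ne_zero (Q : Cube n) : volume Q.set ≠ 0 := by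
  rw [volume_set]
  exact pow_ne_zero _ (by simpa using Q.side_pos)

theorem volume_set_ne_top (Q : Cube n) : volume Q.set ≠ ∞ := by
  rw [volume_set]
  exact ENNReal.pow_ne_top ENNReal.ofReal_ne_top

theorem mem_dyadic_iff (Q : Cube n) (k : ℕ) (m : Fin n → ℕ) (x : Fin n → ℝ) :
    x ∈ (Q.dyadic k m).set ↔
      ∀ i, (m i : ℝ) ≤ (x i - Q.corner i) / Q.side * 2 ^ k ∧
        (x i - Q.corner i) / Q.side * 2 ^ k < m i + 1 := by
  have hs := Q.side_pos
  have h2 : (0 : ℝ) < 2 ^ k := by positivity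
  refine forall_congr' fun i => ?_
  have hx : x i = Q.corner i + Q.side / 2 ^ k * ((x i - Q.corner i) / Q.side * 2 ^ k) := by
    field_simp
    ring
  have hd : 0 < Q.side / 2 ^ k := by positivity
  simp only [dyadic]
  generalize (x i - Q.corner i) / Q.side * 2 ^ k = y at hx ⊢
  rw [hx, add_assoc, add_le_add_iff_left, add_lt_add_iff_left, mul_le_mul_iff_right₀ hd,
    ← mul_add_one, mul_lt_mul_iff_right₀ hd]

theorem dyadic_index_le {Q : Cube n} {k l : ℕ} (hkl : k ≤ l) {m m' : Fin n → ℕ}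
    {x : Fin n → ℝ} (hx : x ∈ (Q.dyadic k m).set) (hx' : x ∈ (Q.dyadic l m').set) (i : Fin n) :
    m i * 2 ^ (l - k) ≤ m' i ∧ m' i + 1 ≤ (m i + 1) * 2 ^ (l - k) := by
  rw [mem_dyadic_iff] at hx hx'
  obtain ⟨d, rfl⟩ := Nat.exists_eq_add_of_le hkl
  obtain ⟨h1, h2⟩ := hx i
  obtain ⟨h3, h4⟩ := hx' i
  rw [pow_add, ← mul_assoc] at h3 h4
  have hd : (0 : ℝ) < 2 ^ d := by positivity
  have h5 := mul_le_mul_of_nonneg_right h1 hd.le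
  have h6 := mul_lt_mul_of_pos_right h2 hd
  rw [Nat.add_sub_cancel_left]
  constructor
  · have : (m i * 2 ^ d : ℝ) < m' i + 1 := h5.trans_lt h4
    exact Nat.lt_succ_iff.1 (by exact_mod_cast this)
  · have : (m' i : ℝ) < (m i + 1) * 2 ^ d := h3.trans_lt h6
    exact Nat.succ_le_iff.2 (by exact_mod_cast this)

theorem dyadic_subset {Q : Cube n} {k l : ℕ} (hkl : k ≤ l) {m m' : Fin n → ℕ}
    (h : ((Q.dyadic k m).set ∩ (Q.dyadic l m').set).Nonempty) :
    (Q.dyadic l m').set ⊆ (Q.dyadic k m).set := by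
  obtain ⟨x, hx, hx'⟩ := h
  have key := dyadic_index_le hkl hx hx'
  intro y hy
  rw [mem_dyadic_iff] at hy ⊢
  intro i
  obtain ⟨d, rfl⟩ := Nat.exists_eq_add_of_le hkl
  obtain ⟨h1, h2⟩ := key i
  obtain ⟨h3, h4⟩ := hy i
  rw [Nat.add_sub_cancel_left] at h1 h2
  rw [pow_add, ← mul_assoc] at h3 h4
  have hd : (0 : ℝ) < 2 ^ d := by positivity
  have h1' : (m i * 2 ^ d : ℝ) ≤ m' i := by exact_mod_cast h1
  have h2' : (m' i + 1 : ℝ) ≤ (m i + 1) * 2 ^ d := by exact_mod_cast h2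
  exact ⟨le_of_mul_le_mul_right (h1'.trans h3) hd,
    lt_of_mul_lt_mul_right (h4.trans_le h2') hd.le⟩

theorem dyadic_index_eq {Q : Cube n} {k : ℕ} {m m' : Fin n → ℕ}
    (h : ((Q.dyadic k m).set ∩ (Q.dyadic k m').set).Nonempty) : m = m' := by
  obtain ⟨x, hx, hx'⟩ := h
  funext i
  have := dyadic_index_le le_rfl hx hx' i
  simp at this
  omega

theorem exists_mem_dyadic {Q : Cube n} {x : Fin n → ℝ} (hx : x ∈ Q.set) (k : ℕ) :
    ∃ m : Fin n → ℕ, (∀ i, m i < 2 ^ k) ∧ x ∈ (Q.dyadic k m).set := by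
  have hs := Q.side_pos
  have h0 : ∀ i, 0 ≤ (x i - Q.corner i) / Q.side * 2 ^ k := fun i => by
    have := (hx i).1
    have : 0 ≤ x i - Q.corner i := by linarith
    positivity
  refine ⟨fun i => ⌊(x i - Q.corner i) / Q.side * 2 ^ k⌋₊, fun i => ?_, ?_⟩
  · rw [Nat.floor_lt (h0 i)]
    have : (x i - Q.corner i) / Q.side < 1 := by
      rw [div_lt_one hs]
      linarith [(hx i).2]
    push_cast
    exact mul_lt_of_lt_one_left (by positivity) this
  · rw [mem_dyadic_iff]
    exact fun i => ⟨Nat.floor_le (h0 i), Nat.lt_floor_add_one _⟩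

theorem dyadic_subset_self (Q : Cube n) {k : ℕ} {m : Fin n → ℕ} (hm : ∀ i, m i < 2 ^ k) :
    (Q.dyadic k m).set ⊆ Q.set := by
  intro x hx
  rw [mem_dyadic_iff] at hx
  intro i
  have hs := Q.side_pos
  have h2 : (0 : ℝ) < 2 ^ k := by positivity
  obtain ⟨h1, h3⟩ := hx i
  have h4 : (m i + 1 : ℝ) ≤ 2 ^ k := by exact_mod_cast hm i
  have h5 : 0 ≤ (x i - Q.corner i) / Q.side :=
    nonneg_of_mul_nonneg_left ((Nat.cast_nonneg _).trans h1) h2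
  have h6 : (x i - Q.corner i) / Q.side < 1 := by
    by_contra! h
    nlinarith
  rw [div_lt_one hs] at h6
  have h7 : 0 ≤ x i - Q.corner i := by
    by_contra! h
    exact absurd h5 (not_le.2 (div_neg_of_neg_of_pos h hs))
  constructor <;> linarith

theorem corner_mem (Q : Cube n) : Q.corner ∈ Q.set :=
  fun i => ⟨le_rfl, by linarith [Q.side_pos]⟩

theorem dyadic_subset_parent (Q : Cube n) (k : ℕ) (m : Fin n → ℕ) :
    (Q.dyadic (k + 1) m).set ⊆ (Q.dyadic k fun i => m i / 2).set := by
  refine dyadic_subset k.le_succ ⟨(Q.dyadic (k + 1) m).corner, ?_, corner_mem _⟩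
  have hc := corner_mem (Q.dyadic (k + 1) m)
  rw [mem_dyadic_iff] at hc ⊢
  intro i
  obtain ⟨h1, h2⟩ := hc i
  rw [pow_succ, ← mul_assoc] at h1 h2
  have h3 : ((m i / 2 : ℕ) : ℝ) * 2 ≤ m i := by exact_mod_cast Nat.div_mul_le_self _ _
  have h4 : (m i + 1 : ℝ) ≤ ((m i / 2 : ℕ) : ℝ) * 2 + 2 := by
    have : m i + 1 ≤ m i / 2 * 2 + 2 := by omega
    exact_mod_cast this
  constructor <;> linarith

theorem volume_dyadic_parent (Q : Cube n) (k : ℕ) (m m' : Fin n → ℕ) :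
    volume (Q.dyadic k m').set = 2 ^ n * volume (Q.dyadic (k + 1) m).set := by
  have h : (Q.dyadic k m').side = 2 * (Q.dyadic (k + 1) m).side := by
    simp only [dyadic, pow_succ]
    field_simp
  rw [volume_set, volume_set, h, ENNReal.ofReal_mul two_pos.le, mul_pow]
  simp

/-- The sub-family of `P` of dyadic cubes contained in no other cube of `P`. -/
def maximalIndices (Q : Cube n) (P : Set (ℕ × (Fin n → ℕ))) : Set (ℕ × (Fin n → ℕ)) :=
  {i ∈ P | ∀ j ∈ P, ((Q.dyadic j.1 j.2).set ∩ (Q.dyadic i.1 i.2).set).Nonempty → i.1 ≤ j.1}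

theorem pairwiseDisjoint_maximalIndices (Q : Cube n) (P : Set (ℕ × (Fin n → ℕ))) :
    (Q.maximalIndices P).PairwiseDisjoint fun i => (Q.dyadic i.1 i.2).set := by
  rintro ⟨k, m⟩ hi ⟨l, m'⟩ hj hne
  rw [Function.onFun, Set.disjoint_iff_inter_eq_empty]
  by_contra! h
  obtain rfl : k = l :=
    le_antisymm (hi.2 _ hj.1 (by rwa [Set.inter_comm])) (hj.2 _ hi.1 h)
  exact hne (congrArg (Prod.mk k) (dyadic_index_eq h))

theorem exists_maximalIndices_superset (Q : Cube n) {P : Set (ℕ × (Fin n → ℕ))}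
    {i : ℕ × (Fin n → ℕ)} (hi : i ∈ P) :
    ∃ j ∈ Q.maximalIndices P, (Q.dyadic i.1 i.2).set ⊆ (Q.dyadic j.1 j.2).set := by
  classical
  have hne : ((Q.dyadic i.1 i.2).set ∩ (Q.dyadic i.1 i.2).set).Nonempty :=
    ⟨_, corner_mem _, corner_mem _⟩
  have hex : ∃ k, ∃ j ∈ P, j.1 = k ∧
      ((Q.dyadic j.1 j.2).set ∩ (Q.dyadic i.1 i.2).set).Nonempty := ⟨i.1, i, hi, rfl, hne⟩
  obtain ⟨j, hj, hjk, hji⟩ := Nat.find_spec hex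
  have hsub : (Q.dyadic i.1 i.2).set ⊆ (Q.dyadic j.1 j.2).set :=
    dyadic_subset (hjk ▸ Nat.find_min' hex ⟨i, hi, rfl, hne⟩) hji
  refine ⟨j, ⟨hj, fun l hl hlj => ?_⟩, hsub⟩
  by_contra! hlt
  have hjl := dyadic_subset hlt.le hlj
  exact Nat.find_min hex (hjk ▸ hlt) ⟨l, hl, rfl, _, hjl (hsub (corner_mem _)), corner_mem _⟩

theorem biUnion_maximalIndices (Q : Cube n) (P : Set (ℕ × (Fin n → ℕ))) :
    ⋃ i ∈ Q.maximalIndices P, (Q.dyadic i.1 i.2).set = ⋃ i ∈ P, (Q.dyadic i.1 i.2).set := by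
  apply subset_antisymm
  · exact Set.biUnion_subset_biUnion_left fun i hi => hi.1
  · refine Set.iUnion₂_subset fun i hi => ?_
    obtain ⟨j, hj, hij⟩ := Q.exists_maximalIndices_superset hi
    exact hij.trans (Set.subset_biUnion_of_mem (u := fun j => (Q.dyadic j.1 j.2).set) hj)

theorem volume_biUnion_eq_tsum (Q : Cube n) (P : Set (ℕ × (Fin n → ℕ))) :
    volume (⋃ i ∈ P, (Q.dyadic i.1 i.2).set) =
      ∑' i : Q.maximalIndices P, volume (Q.dyadic i.1.1 i.1.2).set := by
  rw [← biUnion_maximalIndices, measure_biUnion (Set.to_countable _)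
    (Q.pairwiseDisjoint_maximalIndices P) fun i _ => measurableSet_set _]

theorem mul_volume_biUnion_le_lintegral (Q R : Cube n) {P : Set (ℕ × (Fin n → ℕ))}
    (hPR : ∀ i ∈ P, (Q.dyadic i.1 i.2).set ⊆ R.set) (h : (Fin n → ℝ) → ℝ≥0∞) (c : ℝ≥0∞)
    (hc : ∀ i ∈ P, c * volume (Q.dyadic i.1 i.2).set ≤ ∫⁻ x in (Q.dyadic i.1 i.2).set, h x) :
    c * volume (⋃ i ∈ P, (Q.dyadic i.1 i.2).set) ≤ ∫⁻ x in R.set, h x := by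
  calc c * volume (⋃ i ∈ P, (Q.dyadic i.1 i.2).set)
      = ∑' i : Q.maximalIndices P, c * volume (Q.dyadic i.1.1 i.1.2).set := by
        rw [volume_biUnion_eq_tsum, ENNReal.tsum_mul_left]
    _ ≤ ∑' i : Q.maximalIndices P, ∫⁻ x in (Q.dyadic i.1.1 i.1.2).set, h x :=
        ENNReal.tsum_le_tsum fun i => hc _ i.2.1
    _ = ∫⁻ x in ⋃ i ∈ Q.maximalIndices P, (Q.dyadic i.1 i.2).set, h x :=
        (lintegral_biUnion (Set.to_countable _) (fun i _ => measurableSet_set _)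
          (Q.pairwiseDisjoint_maximalIndices P) _).symm
    _ ≤ ∫⁻ x in R.set, h x :=
        lintegral_mono_set (Set.iUnion₂_subset fun i hi => hPR i hi.1)

theorem ofReal_abs_ravg_sub_mul_volume_le (Q : Cube n) {f : (Fin n → ℝ) → ℝ}
    (hf : IntegrableOn f Q.set) (c : ℝ) :
    ENNReal.ofReal |ravg Q f - c| * volume Q.set
      ≤ ∫⁻ x in Q.set, ENNReal.ofReal |f x - c| := by
  have h0 := volume_set_ne_zero Q
  have ht := volume_set_ne_top Q
  have hv : 0 < volume.real Q.set := ENNReal.toReal_pos h0 ht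
  have hc : IntegrableOn (fun _ => c) Q.set := integrableOn_const ht
  have hi : ∫ x in Q.set, (f x - c) = volume.real Q.set * (ravg Q f - c) := by
    rw [integral_sub hf hc, ravg, setAverage_eq, setIntegral_const, smul_eq_mul, smul_eq_mul]
    field_simp
  have := enorm_integral_le_lintegral_enorm (μ := volume.restrict Q.set) fun x => f x - c
  rw [hi, enorm_mul, mul_comm] at this
  simp only [Real.enorm_eq_ofReal_abs, abs_of_pos hv] at this
  rwa [measureReal_def, ENNReal.ofReal_toReal ht] at this

theorem avg_mul_volume (Q : Cube n) (f : (Fin n → ℝ) → ℝ) :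
    avg Q f * volume Q.set = ∫⁻ x in Q.set, ENNReal.ofReal (f x) :=
  ENNReal.div_mul_cancel (volume_set_ne_zero Q) (volume_set_ne_top Q)

theorem avg_le_sharpMaximal {Q : Cube n} (f : (Fin n → ℝ) → ℝ) {k : ℕ} {m : Fin n → ℕ}
    (hm : ∀ i, m i < 2 ^ k) {x : Fin n → ℝ} (hx : x ∈ (Q.dyadic k m).set) :
    avg (Q.dyadic k m) (fun y => |f y - ravg (Q.dyadic k m) f|) ≤ sharpMaximal Q f x :=
  le_iSup_of_le k <| le_iSup_of_le m <| le_iSup_of_le ⟨hm, hx⟩ le_rfl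

/-- The indices of the dyadic subcubes of `Q` on which the average of `f` differs from that
over `Q` by more than `t`. -/
def bigIndices (Q : Cube n) (f : (Fin n → ℝ) → ℝ) (t : ℝ) : Set (ℕ × (Fin n → ℕ)) :=
  {i | (∀ j, i.2 j < 2 ^ i.1) ∧ t < |ravg (Q.dyadic i.1 i.2) f - ravg Q f|}

/-- The union of the dyadic subcubes of `Q` on which the average of `f` differs from that
over `Q` by more than `t`. -/
def bigSet (Q : Cube n) (f : (Fin n → ℝ) → ℝ) (t : ℝ) : Set (Fin n → ℝ) :=
  ⋃ i ∈ Q.bigIndices f t, (Q.dyadic i.1 i.2).set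

theorem bigSet_subset (Q : Cube n) (f : (Fin n → ℝ) → ℝ) (t : ℝ) : Q.bigSet f t ⊆ Q.set :=
  Set.iUnion₂_subset fun _ hi => Q.dyadic_subset_self hi.1

theorem dyadic_zero (Q : Cube n) {m : Fin n → ℕ} (hm : ∀ i, m i < 2 ^ 0) : Q.dyadic 0 m = Q := by
  obtain ⟨c, s, hs⟩ := Q
  have : ∀ i, m i = 0 := by simpa using hm
  simp [dyadic, this]

theorem abs_ravg_sub_le_of_mem_maximalIndices {Q : Cube n} {f : (Fin n → ℝ) → ℝ}
    (hf : IntegrableOn f Q.set) {t s : ℝ} (ht : 0 < t) (hs : 0 ≤ s) {i : ℕ × (Fin n → ℕ)}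
    (hi : i ∈ Q.maximalIndices (Q.bigIndices f t)) {x : Fin n → ℝ}
    (hx : x ∈ (Q.dyadic i.1 i.2).set) (hxs : sharpMaximal Q f x ≤ ENNReal.ofReal s) :
    |ravg (Q.dyadic i.1 i.2) f - ravg Q f| ≤ t + 2 ^ n * s := by
  obtain ⟨_ | k, m⟩ := i
  · obtain ⟨hm, hlt⟩ := hi.1
    dsimp only at hm hlt
    rw [dyadic_zero Q hm, sub_self, abs_zero] at hlt
    exact absurd hlt ht.not_gt
  · dsimp only at hx ⊢
    have hm : ∀ j, m j < 2 ^ (k + 1) := hi.1.1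
    have hm' : ∀ j, m j / 2 < 2 ^ k := fun j => by
      have := hm j
      rw [pow_succ] at this
      omega
    set S := Q.dyadic (k + 1) m with hS
    set R := Q.dyadic k fun j => m j / 2 with hR
    have hSR : S.set ⊆ R.set := dyadic_subset_parent Q k m
    have h1 : |ravg R f - ravg Q f| ≤ t := by
      by_contra! hlt
      have : k + 1 ≤ k :=
        hi.2 (k, fun j => m j / 2) ⟨hm', hlt⟩ ⟨S.corner, hSR (corner_mem S), corner_mem S⟩
      omega
    have h2 : ENNReal.ofReal |ravg S f - ravg R f| * volume S.set
        ≤ ENNReal.ofReal (2 ^ n * s) * volume S.set :=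
      calc ENNReal.ofReal |ravg S f - ravg R f| * volume S.set
          ≤ ∫⁻ y in S.set, ENNReal.ofReal |f y - ravg R f| :=
            ofReal_abs_ravg_sub_mul_volume_le S (hf.mono_set (Q.dyadic_subset_self hm)) _
        _ ≤ ∫⁻ y in R.set, ENNReal.ofReal |f y - ravg R f| := lintegral_mono_set hSR
        _ = avg R (fun y => |f y - ravg R f|) * volume R.set := (avg_mul_volume R _).symm
        _ ≤ ENNReal.ofReal s * volume R.set :=
            mul_le_mul_left ((avg_le_sharpMaximal f hm' (hSR hx)).trans hxs) _
        _ = ENNReal.ofReal (2 ^ n * s) * volume S.set := by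
            rw [hR, volume_dyadic_parent Q k m, ENNReal.ofReal_mul (by positivity),
              ENNReal.ofReal_pow two_pos.le]
            simp only [ENNReal.ofReal_ofNat]
            ring
    have h3 : |ravg S f - ravg R f| ≤ 2 ^ n * s := by
      have := (ENNReal.mul_le_mul_iff_left (volume_set_ne_zero S) (volume_set_ne_top S)).1 h2
      rwa [ENNReal.ofReal_le_ofReal_iff (by positivity)] at this
    linarith [abs_sub_le (ravg S f) (ravg R f) (ravg Q f)]

theorem bigIndices_anti (Q : Cube n) (f : (Fin n → ℝ) → ℝ) {s t : ℝ} (hst : s ≤ t) :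
    Q.bigIndices f t ⊆ Q.bigIndices f s :=
  fun _ hi => ⟨hi.1, hst.trans_lt hi.2⟩

/-- Good-`λ` inequality. -/
theorem volume_bigSet_two_mul_le {Q : Cube n} {f : (Fin n → ℝ) → ℝ}
    (hf : IntegrableOn f Q.set) {t γ : ℝ} (ht : 0 < t) (hγ : 0 < γ) (hγn : 2 ^ n * γ ≤ 1 / 2) :
    volume (Q.bigSet f (2 * t)) ≤
      volume {x ∈ Q.set | ENNReal.ofReal (γ * t) < sharpMaximal Q f x} +
        ENNReal.ofReal (2 * γ) * volume (Q.bigSet f t) := by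
  set B := {x ∈ Q.set | ENNReal.ofReal (γ * t) < sharpMaximal Q f x} with hB
  set M := Q.maximalIndices (Q.bigIndices f t) with hM
  let P : M → Set (ℕ × (Fin n → ℕ)) := fun i =>
    {j ∈ Q.bigIndices f (2 * t) | (Q.dyadic j.1 j.2).set ⊆ (Q.dyadic i.1.1 i.1.2).set ∧
      ¬ (Q.dyadic i.1.1 i.1.2).set ⊆ B}
  have hcover : Q.bigSet f (2 * t) ⊆ B ∪ ⋃ i : M, ⋃ j ∈ P i, (Q.dyadic j.1 j.2).set := by
    refine Set.iUnion₂_subset fun j hj x hx => ?_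
    obtain ⟨i, hi, hji⟩ :=
      Q.exists_maximalIndices_superset (Q.bigIndices_anti f (by linarith : t ≤ 2 * t) hj)
    by_cases hiB : (Q.dyadic i.1 i.2).set ⊆ B
    · exact Or.inl (hiB (hji hx))
    · exact Or.inr (Set.mem_iUnion.2 ⟨⟨i, hi⟩, Set.mem_iUnion₂.2 ⟨j, ⟨hj, hji, hiB⟩, hx⟩⟩)
  have hpiece : ∀ i : M, volume (⋃ j ∈ P i, (Q.dyadic j.1 j.2).set) ≤
      ENNReal.ofReal (2 * γ) * volume (Q.dyadic i.1.1 i.1.2).set := by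
    intro i
    by_cases hiB : (Q.dyadic i.1.1 i.1.2).set ⊆ B
    · simp [P, hiB]
    have hiv : ∀ j, i.1.2 j < 2 ^ i.1.1 := i.2.1.1
    obtain ⟨x, hx, hxB⟩ := Set.not_subset.1 hiB
    have hxs : sharpMaximal Q f x ≤ ENNReal.ofReal (γ * t) := by
      by_contra! h
      exact hxB ⟨Q.dyadic_subset_self hiv hx, h⟩
    have havg := abs_ravg_sub_le_of_mem_maximalIndices hf ht (by positivity) i.2 hx hxs
    have hosc := (avg_le_sharpMaximal f hiv hx).trans hxs
    set S := Q.dyadic i.1.1 i.1.2 with hS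
    have hweak := mul_volume_biUnion_le_lintegral Q S (P := P i) (fun j hj => hj.2.1)
      (fun y => ENNReal.ofReal |f y - ravg S f|) (ENNReal.ofReal (t / 2)) fun j hj => by
        refine le_trans ?_ (ofReal_abs_ravg_sub_mul_volume_le _
          (hf.mono_set (Q.dyadic_subset_self hj.1.1)) _)
        gcongr
        have h1 := hj.1.2
        have h2 := abs_sub_le (ravg (Q.dyadic j.1 j.2) f) (ravg S f) (ravg Q f)
        nlinarith
    rw [← avg_mul_volume] at hweak
    have h3 := hweak.trans (mul_le_mul_left hosc _)
    have h4 : ENNReal.ofReal (γ * t) = ENNReal.ofReal (t / 2) * ENNReal.ofReal (2 * γ) := by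
      rw [← ENNReal.ofReal_mul (by positivity)]
      congr 1
      ring
    rw [h4, mul_assoc] at h3
    exact (ENNReal.mul_le_mul_iff_right (by simpa using ht) ENNReal.ofReal_ne_top).1 h3
  calc volume (Q.bigSet f (2 * t))
      ≤ volume B + volume (⋃ i : M, ⋃ j ∈ P i, (Q.dyadic j.1 j.2).set) :=
        (measure_mono hcover).trans (measure_union_le _ _)
    _ ≤ volume B + ∑' i : M, ENNReal.ofReal (2 * γ) * volume (Q.dyadic i.1.1 i.1.2).set := by
        gcongr
        exact (measure_iUnion_le _).trans (ENNReal.tsum_le_tsum hpiece)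
    _ = volume B + ENNReal.ofReal (2 * γ) * volume (Q.bigSet f t) := by
        rw [ENNReal.tsum_mul_left, bigSet, volume_biUnion_eq_tsum]

theorem set_ae_eq_closedBall (Q : Cube n) :
    Q.set =ᵐ[volume] Metric.closedBall (fun i => Q.corner i + Q.side / 2) (Q.side / 2) := by
  have hs := Q.side_pos
  have h : Metric.closedBall (fun i => Q.corner i + Q.side / 2) (Q.side / 2) =
      Set.Icc Q.corner fun i => Q.corner i + Q.side := by
    ext x
    rw [Metric.mem_closedBall, dist_pi_le_iff (by positivity), Set.mem_Icc, Pi.le_def, Pi.le_def,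
      ← forall_and]
    refine forall_congr' fun i => ?_
    rw [Real.dist_eq, abs_le]
    constructor <;> rintro ⟨h1, h2⟩ <;> constructor <;> linarith
  rw [h, set_eq_pi]
  exact Measure.univ_pi_Ico_ae_eq_Icc

/-- Lebesgue differentiation along dyadic cubes. -/
theorem ae_mem_bigSet {Q : Cube n} {f : (Fin n → ℝ) → ℝ} (hf : IntegrableOn f Q.set) (t : ℝ) :
    ∀ᵐ x, x ∈ Q.set → t < |f x - ravg Q f| → x ∈ Q.bigSet f t := by
  have hF : LocallyIntegrable (Q.set.indicator f) :=
    (hf.integrable_indicator (measurableSet_set Q)).locallyIntegrable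
  filter_upwards [IsUnifLocDoublingMeasure.ae_tendsto_average volume hF 1] with x hx hxQ hxt
  choose m hm hxm using exists_mem_dyadic hxQ
  have hδ : Tendsto (fun k => (Q.dyadic k (m k)).side / 2) atTop (𝓝[>] 0) := by
    refine tendsto_nhdsWithin_iff.2 ⟨?_, Eventually.of_forall fun k => ?_⟩
    · have h := (tendsto_pow_atTop_nhds_zero_of_lt_one (r := (1 / 2 : ℝ)) (by norm_num)
        (by norm_num)).const_mul (Q.side / 2)
      rw [mul_zero] at h
      refine h.congr fun k => ?_
      simp only [dyadic, one_div, inv_pow]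
      ring
    · exact half_pos (Q.dyadic k (m k)).side_pos
  have hlim := hx (fun k i => (Q.dyadic k (m k)).corner i + (Q.dyadic k (m k)).side / 2) _ hδ
    (Eventually.of_forall fun k => by
      rw [one_mul, Metric.mem_closedBall,
        dist_pi_le_iff (half_pos (Q.dyadic k (m k)).side_pos).le]
      intro i
      have := hxm k i
      rw [Real.dist_eq, abs_le]
      constructor <;> linarith)
  have havg : ∀ k, (⨍ y in Metric.closedBall
      (fun i => (Q.dyadic k (m k)).corner i + (Q.dyadic k (m k)).side / 2)
      ((Q.dyadic k (m k)).side / 2), Q.set.indicator f y) = ravg (Q.dyadic k (m k)) f := by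
    intro k
    rw [← setAverage_congr (set_ae_eq_closedBall _), ravg]
    exact setAverage_congr_fun (measurableSet_set _) (Eventually.of_forall fun y hy =>
      Set.indicator_of_mem (Q.dyadic_subset_self (hm k) hy) f)
  simp only [havg, Set.indicator_of_mem hxQ] at hlim
  obtain ⟨k, hk⟩ := ((hlim.sub_const (ravg Q f)).abs.eventually_const_lt hxt).exists
  exact Set.mem_iUnion₂.2 ⟨(k, m k), ⟨hm k, hk⟩, hxm k⟩

theorem le_two_mul_of_le_half_add {φ : ℝ → ℝ} {p B : ℝ} (hp : 0 ≤ p) (hB : 0 ≤ B)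
    (h1 : ∀ t, 0 < t → φ t ≤ t ^ p) (h2 : ∀ t, 0 < t → φ (2 * t) ≤ φ t / 2 + B)
    {t : ℝ} (ht : 0 < t) : φ t ≤ 2 * B := by
  have key : ∀ k : ℕ, ∀ t, 0 < t → φ t ≤ t ^ p * (1 / 2) ^ k + 2 * B := by
    intro k
    induction k with
    | zero => intro t ht; linarith [h1 t ht]
    | succ k ih =>
      intro t ht
      have h3 := h2 (t / 2) (half_pos ht)
      rw [mul_div_cancel₀ t two_ne_zero] at h3
      have h4 := ih (t / 2) (half_pos ht)
      have h5 : (t / 2) ^ p ≤ t ^ p := Real.rpow_le_rpow (by positivity) (by linarith) hp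
      have h6 := mul_le_mul_of_nonneg_right h5 (by positivity : (0 : ℝ) ≤ (1 / 2) ^ k)
      rw [pow_succ]
      linarith
  refine ge_of_tendsto' (f := fun k : ℕ => t ^ p * (1 / 2) ^ k + 2 * B) (x := atTop) ?_
    fun k => key k t ht
  simpa using ((tendsto_pow_atTop_nhds_zero_of_lt_one (r := (1 / 2 : ℝ)) (by norm_num)
    (by norm_num)).const_mul (t ^ p)).add_const (2 * B)

theorem measure_div_ne_top (Q : Cube n) {s : Set (Fin n → ℝ)} (hs : s ⊆ Q.set) :
    volume s / volume Q.set ≠ ∞ :=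
  ENNReal.div_ne_top (measure_ne_top_of_subset hs (volume_set_ne_top Q)) (volume_set_ne_zero Q)

theorem rpow_mul_toReal_le_wnorm {Q : Cube n} {p : ℝ} (hp : 0 < p) {g : (Fin n → ℝ) → ℝ≥0∞}
    (hg : wnorm Q p g ≠ ∞) {t : ℝ} (ht : 0 < t) :
    t ^ p * (volume {x ∈ Q.set | ENNReal.ofReal t < g x} / volume Q.set).toReal
      ≤ (wnorm Q p g).toReal ^ p := by
  set v := volume {x ∈ Q.set | ENNReal.ofReal t < g x} / volume Q.set with hv
  have h : ENNReal.ofReal t * v ^ (1 / p) ≤ wnorm Q p g := le_iSup₂_of_le t ht le_rfl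
  have h' := ENNReal.toReal_mono hg h
  rw [ENNReal.toReal_mul, ENNReal.toReal_ofReal ht.le, ← ENNReal.toReal_rpow] at h'
  have h'' := Real.rpow_le_rpow (by positivity) h' hp.le
  rwa [Real.mul_rpow ht.le (by positivity), ← Real.rpow_mul ENNReal.toReal_nonneg,
    one_div_mul_cancel hp.ne', Real.rpow_one] at h''

theorem rpow_mul_volume_bigSet_le {Q : Cube n} {f : (Fin n → ℝ) → ℝ} (hf : IntegrableOn f Q.set)
    {p : ℝ} (hp : 0 < p) (hW : wnorm Q p (sharpMaximal Q f) ≠ ∞) {γ : ℝ} (hγ : 0 < γ)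
    (hγn : 2 ^ n * γ ≤ 1 / 2) (hγp : 2 ^ p * (2 * γ) ≤ 1 / 2) {t : ℝ} (ht : 0 < t) :
    t ^ p * (volume (Q.bigSet f t) / volume Q.set).toReal
      ≤ 2 * ((2 / γ) ^ p * (wnorm Q p (sharpMaximal Q f)).toReal ^ p) := by
  have h0 := volume_set_ne_zero Q
  refine le_two_mul_of_le_half_add
    (φ := fun t => t ^ p * (volume (Q.bigSet f t) / volume Q.set).toReal)
    hp.le (by positivity) (fun t ht => ?_) (fun t ht => ?_) ht
  · refine mul_le_of_le_one_right (by positivity) ?_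
    refine ENNReal.toReal_le_of_le_ofReal zero_le_one ?_
    rw [ENNReal.ofReal_one]
    exact ENNReal.div_le_of_le_mul (by rw [one_mul]; exact measure_mono (Q.bigSet_subset f t))
  · have hgood := volume_bigSet_two_mul_le hf ht hγ hγn
    have hweak := rpow_mul_toReal_le_wnorm hp hW (mul_pos hγ ht)
    have hsub : {x ∈ Q.set | ENNReal.ofReal (γ * t) < sharpMaximal Q f x} ⊆ Q.set :=
      Set.sep_subset _ _
    set B := {x ∈ Q.set | ENNReal.ofReal (γ * t) < sharpMaximal Q f x} with hB
    have hgood' : (volume (Q.bigSet f (2 * t)) / volume Q.set).toReal ≤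
        (volume B / volume Q.set).toReal +
          2 * γ * (volume (Q.bigSet f t) / volume Q.set).toReal := by
      have h := ENNReal.div_le_div_right hgood (volume Q.set)
      rw [ENNReal.add_div, mul_div_assoc] at h
      have hB' := Q.measure_div_ne_top hsub
      have hS := ENNReal.mul_ne_top (ENNReal.ofReal_ne_top (r := 2 * γ))
        (Q.measure_div_ne_top (Q.bigSet_subset f t))
      have := ENNReal.toReal_mono (ENNReal.add_ne_top.2 ⟨hB', hS⟩) h
      rwa [ENNReal.toReal_add hB' hS, ENNReal.toReal_mul,
        ENNReal.toReal_ofReal (by positivity)] at this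
    set b := (volume B / volume Q.set).toReal
    set u := (volume (Q.bigSet f t) / volume Q.set).toReal with hu
    have hu0 : 0 ≤ u := ENNReal.toReal_nonneg
    have htp : 0 ≤ t ^ p := by positivity
    have h1 : (2 * t) ^ p * b = (2 / γ) ^ p * ((γ * t) ^ p * b) := by
      rw [← mul_assoc, ← Real.mul_rpow (by positivity) (by positivity)]
      congr 2
      field_simp
    have h2 : (2 * t) ^ p * (2 * γ * u) ≤ t ^ p * u / 2 := by
      rw [Real.mul_rpow two_pos.le ht.le]
      have := mul_le_mul_of_nonneg_right hγp (mul_nonneg htp hu0)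
      linarith
    calc (2 * t) ^ p * (volume (Q.bigSet f (2 * t)) / volume Q.set).toReal
        ≤ (2 * t) ^ p * (b + 2 * γ * u) := by gcongr
      _ = (2 / γ) ^ p * ((γ * t) ^ p * b) + (2 * t) ^ p * (2 * γ * u) := by rw [mul_add, h1]
      _ ≤ (2 / γ) ^ p * (wnorm Q p (sharpMaximal Q f)).toReal ^ p + t ^ p * u / 2 := by gcongr
      _ = _ := add_comm _ _

end Cube

/-- **Fefferman–Stein type inequality for the local dyadic sharp maximal function.** -/
theorem weak_Lp_le_sharpMaximal (n : ℕ) (p : ℝ) (hp : 1 < p) :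
    ∃ C : ℝ, 0 < C ∧
      ∀ (Q₀ : Cube n) (f : (Fin n → ℝ) → ℝ), Measurable f → IntegrableOn f Q₀.set →
        Cube.wnorm Q₀ p (fun x => ENNReal.ofReal |f x - Cube.ravg Q₀ f|)
          ≤ ENNReal.ofReal C * Cube.wnorm Q₀ p (Cube.sharpMaximal Q₀ f) := by
  have hp0 : 0 < p := by linarith
  obtain ⟨γ, hγ, hγn, hγp⟩ : ∃ γ : ℝ, 0 < γ ∧ 2 ^ n * γ ≤ 1 / 2 ∧ 2 ^ p * (2 * γ) ≤ 1 / 2 := by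
    refine ⟨min (1 / 2 / 2 ^ n) (1 / 4 / 2 ^ p), by positivity, ?_, ?_⟩
    · calc (2 : ℝ) ^ n * min (1 / 2 / 2 ^ n) (1 / 4 / 2 ^ p)
          ≤ 2 ^ n * (1 / 2 / 2 ^ n) := by gcongr; exact min_le_left _ _
        _ = 1 / 2 := by field_simp
    · calc (2 : ℝ) ^ p * (2 * min (1 / 2 / 2 ^ n) (1 / 4 / 2 ^ p))
          ≤ 2 ^ p * (2 * (1 / 4 / 2 ^ p)) := by gcongr; exact min_le_right _ _
        _ = 1 / 2 := by field_simp; norm_num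
  refine ⟨2 * (2 / γ), by positivity, fun Q f _ hf => ?_⟩
  by_cases hW : Cube.wnorm Q p (Cube.sharpMaximal Q f) = ∞
  · rw [hW, ENNReal.mul_top (by simpa using hγ)]
    exact le_top
  refine iSup₂_le fun t ht => ?_
  have hmono : volume {x ∈ Q.set | ENNReal.ofReal t < ENNReal.ofReal |f x - Cube.ravg Q f|} ≤
      volume (Q.bigSet f t) := by
    refine measure_mono_ae ?_
    filter_upwards [Cube.ae_mem_bigSet hf t] with x hx hxt
    exact hx hxt.1 (ENNReal.ofReal_lt_ofReal_iff'.1 hxt.2).1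
  have hbound := Cube.rpow_mul_volume_bigSet_le hf hp0 hW hγ hγn hγp ht
  have hfin := Q.measure_div_ne_top (Q.bigSet_subset f t)
  set w := (Cube.wnorm Q p (Cube.sharpMaximal Q f)).toReal with hw
  have hw0 : 0 ≤ w := ENNReal.toReal_nonneg
  have htwo : (2 : ℝ) ≤ 2 ^ p := by
    simpa using Real.rpow_le_rpow_of_exponent_le one_le_two hp.le
  have hreal : t * (volume (Q.bigSet f t) / volume Q.set).toReal ^ (1 / p) ≤ 2 * (2 / γ) * w := by
    refine (Real.rpow_le_rpow_iff (by positivity) (by positivity) hp0).1 ?_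
    rw [Real.mul_rpow ht.le (by positivity), ← Real.rpow_mul ENNReal.toReal_nonneg,
      one_div_mul_cancel hp0.ne', Real.rpow_one, Real.mul_rpow (by positivity) hw0,
      Real.mul_rpow two_pos.le (by positivity), mul_assoc]
    exact hbound.trans (by gcongr)
  calc ENNReal.ofReal t * (volume {x ∈ Q.set |
          ENNReal.ofReal t < ENNReal.ofReal |f x - Cube.ravg Q f|} / volume Q.set) ^ (1 / p)
      ≤ ENNReal.ofReal t * (volume (Q.bigSet f t) / volume Q.set) ^ (1 / p) := by gcongr
    _ = ENNReal.ofReal (t * (volume (Q.bigSet f t) / volume Q.set).toReal ^ (1 / p)) := by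
        rw [ENNReal.ofReal_mul ht.le, ← ENNReal.ofReal_rpow_of_nonneg ENNReal.toReal_nonneg
          (by positivity), ENNReal.ofReal_toReal hfin]
    _ ≤ ENNReal.ofReal (2 * (2 / γ) * w) := ENNReal.ofReal_le_ofReal hreal
    _ = _ := by rw [ENNReal.ofReal_mul (by positivity), hw, ENNReal.ofReal_toReal hW]
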